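/- arXiv:1004.1382 — 2 statements merged into one kernel-verified Lean document; each statement's English description precedes it below -/
import Mathlib

section
/- Suppose h ∈ ℝ[x₁,…,xₙ] is a homogeneous polynomial hyperbolic with respect to e ∈ ℝⁿ, and e′ lies in the hyperbolicity cone of h containing e. Then for every x ∈ ℝⁿ, the degree in t of the univariate polynomial t ↦ h(e + tx) equals the degree in t of t ↦ h(e′ + tx). -/
/-- `h(e) ≠ 0` and for every real `x` and complex `μ`, `h(x + μe) = 0` implies `μ` is real.
(Homogeneity, which is also part of hyperbolicity, is assumed separately.) -/
def IsHyperbolicWrt {n : ℕ} (h : MvPolynomial (Fin n) ℝ) (e : Fin n → ℝ) : Prop :=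
  MvPolynomial.eval e h ≠ 0 ∧
    ∀ (x : Fin n → ℝ) (μ : ℂ),
      MvPolynomial.aeval (fun i => (x i : ℂ) + μ * (e i : ℂ)) h = 0 → μ.im = 0

/-- The hyperbolicity cone of `h` at `e`: those `x` for which the univariate polynomial
`t ↦ h(x + te)` has only negative zeros. -/
def hypCone {n : ℕ} (h : MvPolynomial (Fin n) ℝ) (e : Fin n → ℝ) : Set (Fin n → ℝ) :=
  {x | ∀ μ : ℂ, MvPolynomial.aeval (fun i => (x i : ℂ) + μ * (e i : ℂ)) h = 0 →
    ∃ r : ℝ, μ = (r : ℂ) ∧ r < 0}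

/-- A real zero polynomial: for every real `x` and complex `μ`, `p(μx) = 0` implies `μ` real. -/
def IsRealZeroPoly {n : ℕ} (p : MvPolynomial (Fin n) ℝ) : Prop :=
  ∀ (x : Fin n → ℝ) (μ : ℂ),
    MvPolynomial.aeval (fun i => μ * (x i : ℂ)) p = 0 → μ.im = 0

open Polynomial Filter Topology

section LinePoly

variable {n d : ℕ} {A B : Type*} [CommRing A] [Algebra ℝ A] [CommRing B] [Algebra ℝ B]

/-- The univariate polynomial `t ↦ h(v + t w)`. -/
noncomputable def linePoly (h : MvPolynomial (Fin n) ℝ) (v w : Fin n → A) : A[X] :=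
  MvPolynomial.aeval (fun i => C (v i) + X * C (w i)) h

theorem eval_linePoly (h : MvPolynomial (Fin n) ℝ) (v w : Fin n → A) (t : A) :
    (linePoly h v w).eval t = MvPolynomial.aeval (v + t • w) h := by
  have := MvPolynomial.comp_aeval_apply (fun i => C (v i) + X * C (w i))
    ((Polynomial.aeval (R := A) t).restrictScalars ℝ) h
  rw [← coe_aeval_eq_eval]
  refine this.trans ?_
  congr 1
  congr 1
  ext i
  simp only [AlgHom.restrictScalars_apply, map_add, map_mul, aeval_C, aeval_X, Algebra.algebraMap_self,
    RingHom.id_apply, Pi.add_apply, Pi.smul_apply, smul_eq_mul]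

theorem map_linePoly (h : MvPolynomial (Fin n) ℝ) (v w : Fin n → A) (φ : A →ₐ[ℝ] B) :
    (linePoly h v w).map (φ : A →+* B) = linePoly h (φ ∘ v) (φ ∘ w) := by
  have := MvPolynomial.comp_aeval_apply (fun i => C (v i) + X * C (w i))
    (Polynomial.mapAlgHom φ) h
  refine this.trans ?_
  unfold linePoly
  congr 1
  congr 1
  ext1 i
  simp

theorem natDegree_linePoly_le {h : MvPolynomial (Fin n) ℝ} (hhom : h.IsHomogeneous d)
    (v w : Fin n → A) : (linePoly h v w).natDegree ≤ d := by
  rw [linePoly, ← MvPolynomial.aeval_map_algebraMap A]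
  refine (MvPolynomial.aeval_natDegree_le _ (hhom.map _).totalDegree_le _ (n := 1)
    fun i => ?_).trans_eq (mul_one d)
  compute_degree

theorem aeval_smul_of_isHomogeneous {h : MvPolynomial (Fin n) ℝ} (hhom : h.IsHomogeneous d)
    (c : A) (v : Fin n → A) :
    MvPolynomial.aeval (c • v) h = c ^ d * MvPolynomial.aeval v h := by
  simp only [MvPolynomial.aeval_def, MvPolynomial.eval₂_eq, Finset.mul_sum]
  refine Finset.sum_congr rfl fun s hs => ?_
  have hd : ∑ i ∈ s.support, s i = d := by
    have := hhom (MvPolynomial.mem_support_iff.mp hs)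
    exact (DFunLike.congr_fun Finsupp.degree_eq_weight_one s).trans this
  simp only [Pi.smul_apply, smul_eq_mul, mul_pow, Finset.prod_mul_distrib,
    Finset.prod_pow_eq_pow_sum, hd]
  ring

end LinePoly

section Complexification

variable {n d : ℕ}

/-- The inclusion of `ℝⁿ` into `ℂⁿ`. -/
def complexify (x : Fin n → ℝ) : Fin n → ℂ := fun i => (x i : ℂ)

theorem aeval_complexify (h : MvPolynomial (Fin n) ℝ) (x : Fin n → ℝ) :
    MvPolynomial.aeval (complexify x) h = ((MvPolynomial.eval x h : ℝ) : ℂ) := by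
  have := MvPolynomial.comp_aeval_apply x Complex.ofRealAm h
  rw [MvPolynomial.aeval_eq_eval] at this
  exact this.symm

theorem aeval_star (h : MvPolynomial (Fin n) ℝ) (z : Fin n → ℂ) :
    MvPolynomial.aeval (star z) h = star (MvPolynomial.aeval z h) :=
  (MvPolynomial.comp_aeval_apply z Complex.conjAe.toAlgHom h).symm

theorem continuous_aeval_complex (h : MvPolynomial (Fin n) ℝ) :
    Continuous fun z : Fin n → ℂ => MvPolynomial.aeval z h := by
  simp only [MvPolynomial.aeval_def, MvPolynomial.eval₂_eq]
  fun_prop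

theorem linePoly_eq_reflect {h : MvPolynomial (Fin n) ℝ} (hhom : h.IsHomogeneous d)
    (v w : Fin n → ℂ) : linePoly h v w = (linePoly h w v).reflect d := by
  refine Polynomial.eq_of_infinite_eval_eq _ _ (Set.Infinite.mono ?_
    (Set.finite_singleton (0 : ℂ)).infinite_compl)
  intro t ht
  have ht : t ≠ 0 := ht
  let : Invertible (t⁻¹) := invertibleOfNonzero (inv_ne_zero ht)
  have h1 := eval₂_reflect_mul_pow (RingHom.id ℂ) t⁻¹ d (linePoly h w v)
    (natDegree_linePoly_le hhom w v)
  rw [invOf_eq_inv, inv_inv] at h1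
  change eval t _ * _ = eval _ _ at h1
  rw [eval_linePoly] at h1
  change eval t _ = eval t _
  rw [eval_linePoly, show v + t • w = t • (w + t⁻¹ • v) by
    rw [smul_add, smul_inv_smul₀ ht, add_comm], aeval_smul_of_isHomogeneous hhom, ← h1, mul_left_comm,
    inv_pow, mul_inv_cancel₀ (pow_ne_zero d ht), mul_one]

theorem coeff_linePoly {h : MvPolynomial (Fin n) ℝ} (hhom : h.IsHomogeneous d)
    (v w : Fin n → ℂ) : (linePoly h v w).coeff d = MvPolynomial.aeval w h := by
  rw [linePoly_eq_reflect hhom, coeff_reflect, revAt_le le_rfl, Nat.sub_self,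
    coeff_zero_eq_eval_zero, eval_linePoly, zero_smul, add_zero]

theorem natDegree_linePoly {h : MvPolynomial (Fin n) ℝ} (hhom : h.IsHomogeneous d)
    (v : Fin n → ℂ) {w : Fin n → ℂ} (hw : MvPolynomial.aeval w h ≠ 0) :
    (linePoly h v w).natDegree = d :=
  natDegree_eq_of_le_of_coeff_ne_zero (natDegree_linePoly_le hhom v w)
    (by rwa [coeff_linePoly hhom])

theorem leadingCoeff_linePoly {h : MvPolynomial (Fin n) ℝ} (hhom : h.IsHomogeneous d)
    (v : Fin n → ℂ) {w : Fin n → ℂ} (hw : MvPolynomial.aeval w h ≠ 0) :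
    (linePoly h v w).leadingCoeff = MvPolynomial.aeval w h := by
  rw [leadingCoeff, natDegree_linePoly hhom v hw, coeff_linePoly hhom]

end Complexification

/-- If no root of `p` has positive imaginary part, then `|p|` is at least
`|leading coefficient| * (Im t) ^ deg p` on the upper half plane. -/
theorem le_norm_eval_of_roots_im_nonpos (p : ℂ[X]) (hp : ∀ z ∈ p.roots, z.im ≤ 0) {t : ℂ}
    (ht : 0 ≤ t.im) : ‖p.leadingCoeff‖ * t.im ^ p.natDegree ≤ ‖p.eval t‖ := by
  have hs := IsAlgClosed.splits p
  rw [hs.eval_eq_prod_roots, norm_mul, hs.natDegree_eq_card_roots]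
  gcongr
  generalize p.roots = s at hp
  induction s using Multiset.induction with
  | empty => simp
  | cons a s ih =>
    simp only [Multiset.map_cons, Multiset.prod_cons, norm_mul, Multiset.card_cons, pow_succ']
    gcongr
    · have h1 := hp a (Multiset.mem_cons_self a s)
      have h2 := (le_abs_self _).trans (Complex.abs_im_le_norm (t - a))
      rw [Complex.sub_im] at h2
      linarith
    · exact ih fun z hz => hp z (Multiset.mem_cons_of_mem hz)

/-- If all roots of `p` lie in the closed disc of radius `r`, the coefficients of `p` are bounded
in terms of its leading coefficient. -/
theorem norm_coeff_le_of_roots_le (p : ℂ[X]) {r : ℝ} (hp : ∀ z, p.eval z = 0 → ‖z‖ ≤ r) (j : ℕ) :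
    ‖p.coeff j‖ ≤ ‖p.leadingCoeff‖ * (r ^ (p.natDegree - j) * p.natDegree.choose j) := by
  rcases eq_or_ne p 0 with rfl | h0
  · simp
  have hl := leadingCoeff_ne_zero.mpr h0
  have hm := monic_mul_leadingCoeff_inv h0
  have key := coeff_le_of_roots_le (f := RingHom.id ℂ) (B := r) j hm (IsAlgClosed.splits _)
    (fun z hz => hp z (by
      rw [Polynomial.map_id] at hz
      have := (mem_roots'.mp hz).2
      simpa [IsRoot, hl] using this))
  rw [Polynomial.map_id, coeff_mul_C, natDegree_mul_leadingCoeff_inv _ h0, norm_mul, norm_inv] at key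
  have hl' : 0 < ‖p.leadingCoeff‖ := norm_pos_iff.mpr hl
  rwa [mul_inv_le_iff₀' hl'] at key

section Hyperbolic

variable {n d : ℕ} {h : MvPolynomial (Fin n) ℝ} {e e' : Fin n → ℝ}

theorem IsHyperbolicWrt.aeval_ne_zero (hhyp : IsHyperbolicWrt h e) (x : Fin n → ℝ) {μ : ℂ}
    (hμ : μ.im ≠ 0) : MvPolynomial.aeval (complexify x + μ • complexify e) h ≠ 0 :=
  fun H => hμ (hhyp.2 x μ H)

theorem aeval_complexify_ne_zero_of_mem_hypCone (he' : e' ∈ hypCone h e) :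
    MvPolynomial.aeval (complexify e') h ≠ 0 := by
  intro H
  obtain ⟨r, hr, hr0⟩ := he' 0 (by
    change MvPolynomial.aeval (complexify e' + (0 : ℂ) • complexify e) h = 0
    rwa [zero_smul, add_zero])
  exact hr0.ne (by exact_mod_cast hr.symm)

/-- For `x` real, `α > 0` and `e'` in the hyperbolicity cone, all roots of
`u ↦ h(x + iαe + ue')` lie in the open lower half plane. -/
theorem aeval_add_smul_ne_zero (hhom : h.IsHomogeneous d) (hhyp : IsHyperbolicWrt h e)
    (he' : e' ∈ hypCone h e) (x : Fin n → ℝ) {α : ℝ} (hα : 0 < α) {u : ℂ} (hu : 0 ≤ u.im) :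
    MvPolynomial.aeval (complexify x + (α * Complex.I) • complexify e + u • complexify e') h ≠ 0 := by
  have hE := aeval_complexify_ne_zero_of_mem_hypCone he'
  let v : ℝ → Fin n → ℂ := fun σ => complexify (σ • x) + (α * Complex.I) • complexify e
  have hv : Continuous v := by
    unfold v complexify
    simp only [Pi.smul_apply, smul_eq_mul]
    fun_prop
  have hreal : ∀ (σ : ℝ) (t : ℂ), t.im = 0 →
      MvPolynomial.aeval (v σ + t • complexify e') h ≠ 0 := by
    intro σ t ht
    have := hhyp.aeval_ne_zero (σ • x + t.re • e') (μ := α * Complex.I) (by simpa using hα.ne')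
    convert this using 3
    have ht' : t = (t.re : ℂ) := Complex.ext (by simp) (by simp [ht])
    rw [ht']
    ext i
    simp [v, complexify]
    ring
  let S : Set ℝ := {σ | ∀ t : ℂ, 0 ≤ t.im → MvPolynomial.aeval (v σ + t • complexify e') h ≠ 0}
  have h0 : (0 : ℝ) ∈ S := by
    intro t ht H
    have hv0 : v 0 = (α * Complex.I) • complexify e := by
      ext i; simp [v, complexify]
    have ht0 : t ≠ 0 := by
      rintro rfl
      exact hreal 0 0 rfl H
    rw [hv0, show (α * Complex.I) • complexify e + t • complexify e' =
      t • (complexify e' + (t⁻¹ * (α * Complex.I)) • complexify e) by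
        rw [smul_add, smul_smul t, mul_inv_cancel_left₀ ht0, add_comm],
      aeval_smul_of_isHomogeneous hhom] at H
    obtain ⟨r, hr, hr0⟩ := he' _ ((mul_eq_zero.mp H).resolve_left (pow_ne_zero _ ht0))
    have h1 : α * Complex.I = t * r := by
      rw [← hr, mul_inv_cancel_left₀ ht0]
    have h2 := congrArg Complex.im h1
    simp at h2
    nlinarith
  have hclosed : IsClosed S := by
    have hS : S = ⋂ t : {t : ℂ // 0 < t.im}, {σ | ‖MvPolynomial.aeval (complexify e') h‖ *
        t.1.im ^ d ≤ ‖MvPolynomial.aeval (v σ + t.1 • complexify e') h‖} := by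
      ext σ
      simp only [Set.mem_iInter, Subtype.forall, Set.mem_ofPred_eq]
      constructor
      · intro hσ t ht
        have := le_norm_eval_of_roots_im_nonpos (linePoly h (v σ) (complexify e'))
          (fun z hz => by
            by_contra! hz'
            have := (mem_roots'.mp hz).2
            rw [IsRoot, eval_linePoly] at this
            exact hσ z hz'.le this) ht.le
        rwa [leadingCoeff_linePoly hhom _ hE, natDegree_linePoly hhom _ hE, eval_linePoly] at this
      · intro hσ t ht
        rcases ht.eq_or_lt with ht | ht
        · exact hreal σ t ht.symm
        · rw [← norm_pos_iff]
          exact lt_of_lt_of_le (by positivity) (hσ t ht)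
    rw [hS]
    refine isClosed_iInter fun t => isClosed_le continuous_const ?_
    exact ((continuous_aeval_complex h).comp (by fun_prop)).norm
  have hopen : IsOpen S := by
    let K : Set (ℝ × ℂ) := {p | 0 ≤ p.1 ∧ 0 ≤ p.2.im ∧ p.1 + ‖p.2‖ = 1}
    have hK : IsCompact K := by
      refine (isCompact_closedBall (0 : ℝ × ℂ) 1).of_isClosed_subset ?_ ?_
      · refine (isClosed_le continuous_const continuous_fst).inter
          ((isClosed_le continuous_const (Complex.continuous_im.comp continuous_snd)).inter
            (isClosed_eq (continuous_fst.add continuous_snd.norm) continuous_const))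
      · rintro ⟨a, b⟩ ⟨h1, -, h2⟩
        simp only at h1 h2
        rw [mem_closedBall_zero_iff, Prod.norm_def, max_le_iff, Real.norm_of_nonneg h1]
        constructor <;> linarith [norm_nonneg b]
    have : CompactSpace K := isCompact_iff_compactSpace.mp hK
    let Z : Set (K × ℝ) := {q | MvPolynomial.aeval
      ((q.1.1.1 : ℂ) • v q.2 + q.1.1.2 • complexify e') h = 0}
    have hZ : IsClosed Z :=
      isClosed_eq ((continuous_aeval_complex h).comp (by fun_prop)) continuous_const
    rw [← isClosed_compl_iff]
    convert isClosedMap_snd_of_compactSpace _ hZ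
    ext σ
    simp only [S, Set.mem_compl_iff, Set.mem_ofPred_eq, not_forall, not_not, Set.mem_image,
      Prod.exists, exists_eq_right, Subtype.exists, Z]
    constructor
    · rintro ⟨t, ht, H⟩
      have hp : 0 < 1 + ‖t‖ := by positivity
      refine ⟨(1 + ‖t‖)⁻¹, ((1 + ‖t‖)⁻¹ : ℝ) * t, ⟨by positivity, ?_, ?_⟩, ?_⟩
      · simp only [Complex.im_ofReal_mul]
        positivity
      · simp only [norm_mul, Complex.norm_real, Real.norm_of_nonneg (inv_nonneg.mpr hp.le)]
        field_simp
      · rw [mul_smul, ← smul_add, aeval_smul_of_isHomogeneous hhom, H, mul_zero]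
    · rintro ⟨a, b, ⟨ha, hb, hab⟩, H⟩
      simp only at ha hb hab H
      have ha0 : a ≠ 0 := by
        rintro rfl
        rw [Complex.ofReal_zero, zero_smul, zero_add, aeval_smul_of_isHomogeneous hhom] at H
        refine mul_ne_zero (pow_ne_zero _ ?_) hE H
        rintro rfl
        simp at hab
      have ha0' : (a : ℂ) ≠ 0 := by exact_mod_cast ha0
      refine ⟨(a⁻¹ : ℝ) * b, ?_, ?_⟩
      · rw [Complex.im_ofReal_mul]
        positivity
      · rw [show (a : ℂ) • v σ + b • complexify e' =
          (a : ℂ) • (v σ + ((a⁻¹ : ℝ) * b) • complexify e') by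
            rw [smul_add (a : ℂ) (v σ), Complex.ofReal_inv, smul_smul, mul_inv_cancel_left₀ ha0'],
          aeval_smul_of_isHomogeneous hhom] at H
        exact (mul_eq_zero.mp H).resolve_left (pow_ne_zero _ ha0')
  have hS := IsClopen.eq_univ ⟨hclosed, hopen⟩ ⟨0, h0⟩
  have h1 : (1 : ℝ) ∈ S := hS ▸ Set.mem_univ _
  simpa [v] using h1 u hu

theorem finite_roots_line (hhom : h.IsHomogeneous d) (hhyp : IsHyperbolicWrt h e)
    (y : Fin n → ℝ) :
    {r : ℝ | MvPolynomial.aeval (complexify y + (r : ℂ) • complexify e) h = 0}.Finite := by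
  have hE : MvPolynomial.aeval (complexify e) h ≠ 0 := by
    rw [aeval_complexify]
    exact_mod_cast hhyp.1
  have h0 : linePoly h (complexify y) (complexify e) ≠ 0 := by
    rw [← leadingCoeff_ne_zero, leadingCoeff_linePoly hhom _ hE]
    exact hE
  refine ((finite_setOfPred_isRoot h0).preimage Complex.ofReal_injective.injOn).subset fun r hr => ?_
  simpa [IsRoot, eval_linePoly] using hr

theorem add_smul_mem_hypCone (hhyp : IsHyperbolicWrt h e) {y : Fin n → ℝ} {R : ℝ}
    (hR : ∀ r : ℝ, MvPolynomial.aeval (complexify y + (r : ℂ) • complexify e) h = 0 → r < R) :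
    y + R • e ∈ hypCone h e := by
  intro μ hμ
  change MvPolynomial.aeval (complexify (y + R • e) + μ • complexify e) h = 0 at hμ
  have hμr : μ.im = 0 := hhyp.2 _ μ hμ
  have hμ' : μ = (μ.re : ℂ) := Complex.ext (by simp) (by simp [hμr])
  refine ⟨μ.re, hμ', ?_⟩
  have := hR (R + μ.re) (by
    rw [hμ'] at hμ
    convert hμ using 3
    ext i
    simp [complexify]
    ring)
  linarith

theorem exists_forall_add_smul_mem_hypCone (hhom : h.IsHomogeneous d)
    (hhyp : IsHyperbolicWrt h e) (y : Fin n → ℝ) :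
    ∃ R₀ : ℝ, ∀ R, R₀ < R → y + R • e ∈ hypCone h e := by
  obtain ⟨R₀, hR₀⟩ := (finite_roots_line hhom hhyp y).bddAbove
  exact ⟨R₀, fun R hR => add_smul_mem_hypCone hhyp fun r hr => (hR₀ hr).trans_lt hR⟩

theorem exists_sub_smul_mem_hypCone (hhom : h.IsHomogeneous d) (hhyp : IsHyperbolicWrt h e)
    (he' : e' ∈ hypCone h e) : ∃ δ : ℝ, 0 < δ ∧ e' - δ • e ∈ hypCone h e := by
  have hfin := finite_roots_line hhom hhyp e'
  have hev : ∀ᶠ δ in 𝓝[>] (0 : ℝ),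
      ∀ r ∈ {r : ℝ | MvPolynomial.aeval (complexify e' + (r : ℂ) • complexify e) h = 0},
        r < -δ := by
    rw [hfin.eventually_all]
    intro r hr
    obtain ⟨s, hs, hs0⟩ := he' r hr
    have hrs : r = s := by exact_mod_cast hs
    filter_upwards [nhdsWithin_le_nhds (Iio_mem_nhds (show 0 < -r by linarith))] with δ hδ
    linarith [Set.mem_Iio.mp hδ]
  obtain ⟨δ, hδ, hδ0⟩ := (hev.and self_mem_nhdsWithin).exists
  refine ⟨δ, hδ0, ?_⟩
  rw [sub_eq_add_neg, ← neg_smul]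
  exact add_smul_mem_hypCone hhyp fun r hr => hδ r hr

theorem IsHyperbolicWrt.of_mem_hypCone (hhom : h.IsHomogeneous d) (hhyp : IsHyperbolicWrt h e)
    (he' : e' ∈ hypCone h e) : IsHyperbolicWrt h e' := by
  obtain ⟨δ, hδ, hcone⟩ := exists_sub_smul_mem_hypCone hhom hhyp he'
  have hpos : ∀ (x : Fin n → ℝ) (μ : ℂ), 0 < μ.im →
      MvPolynomial.aeval (complexify x + μ • complexify e') h ≠ 0 := by
    intro x μ hμ
    have := aeval_add_smul_ne_zero hhom hhyp hcone (x + (μ.re * δ) • e) (α := μ.im * δ)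
      (mul_pos hμ hδ) hμ.le
    convert this using 3
    ext i
    have : μ = μ.re + μ.im * Complex.I := (Complex.re_add_im μ).symm
    simp only [complexify, Pi.add_apply, Pi.smul_apply, Pi.sub_apply, smul_eq_mul,
      Complex.ofReal_add, Complex.ofReal_mul, Complex.ofReal_sub]
    linear_combination (δ * e i : ℂ) * this
  refine ⟨fun H => aeval_complexify_ne_zero_of_mem_hypCone he' ?_, fun x μ hμ => ?_⟩
  · rw [aeval_complexify, H, Complex.ofReal_zero]
  · change MvPolynomial.aeval (complexify x + μ • complexify e') h = 0 at hμ
    rcases lt_trichotomy μ.im 0 with hlt | heq | hgt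
    · refine absurd ?_ (hpos x (star μ) (by simpa using hlt))
      rw [← star_eq_zero, ← aeval_star] at hμ
      convert hμ using 3
      ext i
      simp [complexify]
    · exact heq
    · exact absurd hμ (hpos x μ hgt)

theorem exists_pos_forall_im_ge (hhom : h.IsHomogeneous d) (hhyp : IsHyperbolicWrt h e)
    (y : Fin n → ℝ) : ∃ c : ℝ, 0 < c ∧ ∀ (x : Fin n → ℝ) (t : ℝ) (u : ℂ), 0 < t →
      MvPolynomial.aeval (complexify x + (t * Complex.I) • complexify e + u • complexify y) h = 0 →
      c * t ≤ |u.im| := by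
  obtain ⟨R₁, hR₁⟩ := exists_forall_add_smul_mem_hypCone hhom hhyp y
  obtain ⟨R₂, hR₂⟩ := exists_forall_add_smul_mem_hypCone hhom hhyp (-y)
  let R := max 0 (max R₁ R₂) + 1
  have hR : 0 < R := by positivity
  have h1 : y + R • e ∈ hypCone h e :=
    hR₁ R (lt_of_le_of_lt ((le_max_left _ _).trans (le_max_right _ _)) (lt_add_one _))
  have h2 : -y + R • e ∈ hypCone h e :=
    hR₂ R (lt_of_le_of_lt ((le_max_right _ _).trans (le_max_right _ _)) (lt_add_one _))
  refine ⟨R⁻¹, inv_pos.mpr hR, fun x t u ht H => ?_⟩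
  by_contra! hlt
  have hα : 0 < t - |u.im| * R := by
    rw [inv_mul_eq_div, lt_div_iff₀ hR] at hlt
    linarith
  have hu : u = u.re + u.im * Complex.I := (Complex.re_add_im u).symm
  rcases le_total 0 u.im with hs | hs
  · refine aeval_add_smul_ne_zero hhom hhyp h1 (x + u.re • y) hα
      (u := |u.im| * Complex.I) (by simp) ?_
    convert H using 3
    ext i
    rw [abs_of_nonneg hs]
    simp only [complexify, Pi.add_apply, Pi.smul_apply, smul_eq_mul,
      Complex.ofReal_add, Complex.ofReal_mul, Complex.ofReal_sub]
    linear_combination (-y i : ℂ) * hu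
  · refine aeval_add_smul_ne_zero hhom hhyp h2 (x + u.re • y) hα
      (u := |u.im| * Complex.I) (by simp) ?_
    convert H using 3
    ext i
    rw [abs_of_nonpos hs]
    simp only [complexify, Pi.add_apply, Pi.smul_apply, Pi.neg_apply, smul_eq_mul,
      Complex.ofReal_add, Complex.ofReal_mul, Complex.ofReal_sub, Complex.ofReal_neg]
    linear_combination (-y i : ℂ) * hu

/-- The degree along `x` of a hyperbolic polynomial is largest when starting from the
direction of hyperbolicity. -/
theorem natDegree_linePoly_le_of_isHyperbolicWrt (hhom : h.IsHomogeneous d)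
    (hhyp : IsHyperbolicWrt h e) (y x : Fin n → ℝ) :
    (linePoly h (complexify y) (complexify x)).natDegree ≤
      (linePoly h (complexify e) (complexify x)).natDegree := by
  obtain ⟨c, hc, hroot⟩ := exists_pos_forall_im_ge hhom hhyp y
  set P := linePoly h (complexify e) (complexify x) with hP
  rw [natDegree_le_iff_coeff_eq_zero]
  intro j hj
  rcases lt_or_ge d j with hdj | hjd
  · exact coeff_eq_zero_of_natDegree_lt ((natDegree_linePoly_le hhom _ _).trans_lt hdj)
  let F : ℂ[X][X] := linePoly h (fun i => C (complexify y i))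
    (fun i => C (complexify x i) + X * C (complexify e i))
  have hF : ∀ t : ℂ, (F.coeff j).eval t =
      (linePoly h (complexify y) (complexify x + t • complexify e)).coeff j := by
    intro t
    have := map_linePoly h (fun i => C (complexify y i))
      (fun i => C (complexify x i) + X * C (complexify e i))
      ((Polynomial.aeval (R := ℂ) t).restrictScalars ℝ)
    have h2 := congrArg (fun p => p.coeff j) this
    simp only [coeff_map] at h2
    rw [← coe_aeval_eq_eval]
    refine h2.trans ?_
    congr 2 <;> ext i <;> simp only [Function.comp_apply, AlgHom.restrictScalars_apply, map_add,
      map_mul, aeval_C, aeval_X, Algebra.algebraMap_self, RingHom.id_apply, Pi.add_apply, Pi.smul_apply,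
      smul_eq_mul]
  have hval : ∀ t : ℝ, MvPolynomial.aeval (complexify x + (t * Complex.I) • complexify e) h
      = (P.reflect d).eval (t * Complex.I) := by
    intro t
    rw [hP, ← linePoly_eq_reflect hhom, eval_linePoly]
  have hdvd : X ^ (d - P.natDegree) ∣ P.reflect d := by
    rw [X_pow_dvd_iff]
    intro i hi
    rw [coeff_reflect, revAt_le (by omega)]
    exact coeff_eq_zero_of_natDegree_lt (by omega)
  obtain ⟨Q, hQ⟩ := hdvd
  have hbound : ∀ t : ℝ, 0 < t → ‖(F.coeff j).eval (t * Complex.I)‖ ≤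
      t ^ (j - P.natDegree) * (‖Q.eval (t * Complex.I)‖ * ((c⁻¹) ^ (d - j) * d.choose j)) := by
    intro t ht
    have hne := hhyp.aeval_ne_zero x (μ := t * Complex.I) (by simpa using ht.ne')
    have h1 := norm_coeff_le_of_roots_le
      (linePoly h (complexify y) (complexify x + (t * Complex.I : ℂ) • complexify e))
      (r := (c * t)⁻¹) (fun z hz => by
        rcases eq_or_ne z 0 with rfl | hz0
        · rw [norm_zero]; positivity
        rw [eval_linePoly, show complexify y + z • (complexify x + (t * Complex.I : ℂ) • complexify e)
          = z • (complexify x + (t * Complex.I : ℂ) • complexify e + z⁻¹ • complexify y) by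
            rw [smul_add z _ (z⁻¹ • _), smul_inv_smul₀ hz0, add_comm],
          aeval_smul_of_isHomogeneous hhom] at hz
        have h2 := hroot x t z⁻¹ ht ((mul_eq_zero.mp hz).resolve_left (pow_ne_zero _ hz0))
        have h3 := h2.trans (Complex.abs_im_le_norm _)
        rw [norm_inv] at h3
        exact (le_inv_comm₀ (by positivity) (norm_pos_iff.mpr hz0)).mp h3) j
    rw [leadingCoeff_linePoly hhom _ hne, natDegree_linePoly hhom _ hne, ← hF, hval t, hQ,
      eval_mul, eval_pow, eval_X, norm_mul, norm_pow, norm_mul, Complex.norm_I, mul_one,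
      Complex.norm_real, Real.norm_of_nonneg ht.le,
      show d - P.natDegree = (j - P.natDegree) + (d - j) by omega, pow_add, mul_inv, mul_pow,
      inv_pow t] at h1
    refine h1.trans_eq ?_
    have : t ^ (d - j) ≠ 0 := pow_ne_zero _ ht.ne'
    field_simp
  have hlim1 : Tendsto (fun t : ℝ => ‖(F.coeff j).eval (t * Complex.I)‖) (𝓝[>] 0)
      (𝓝 ‖(F.coeff j).eval 0‖) := by
    have : Continuous fun t : ℝ => ‖(F.coeff j).eval (t * Complex.I)‖ := by fun_prop
    simpa using (this.tendsto 0).mono_left nhdsWithin_le_nhds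
  have hlim2 : Tendsto (fun t : ℝ => t ^ (j - P.natDegree) *
      (‖Q.eval (t * Complex.I)‖ * ((c⁻¹) ^ (d - j) * d.choose j))) (𝓝[>] 0) (𝓝 0) := by
    have : Continuous fun t : ℝ => t ^ (j - P.natDegree) *
      (‖Q.eval (t * Complex.I)‖ * ((c⁻¹) ^ (d - j) * d.choose j)) := by fun_prop
    have h3 := (this.tendsto 0).mono_left (nhdsWithin_le_nhds (s := Set.Ioi 0))
    rwa [zero_pow (by omega), zero_mul] at h3
  have hle := le_of_tendsto_of_tendsto hlim1 hlim2
    (by filter_upwards [self_mem_nhdsWithin] with t ht using hbound t ht)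
  have := norm_le_zero_iff.mp hle
  rwa [hF, zero_smul, add_zero] at this

end Hyperbolic

theorem natDegree_linePoly_complexify {n : ℕ} (h : MvPolynomial (Fin n) ℝ) (v w : Fin n → ℝ) :
    (linePoly h (complexify v) (complexify w)).natDegree = (linePoly h v w).natDegree := by
  have := map_linePoly h v w Complex.ofRealAm
  rw [← natDegree_map (p := linePoly h v w) (Complex.ofRealAm : ℝ →+* ℂ), this]
  rfl

theorem stmt17 (n d : ℕ) (h : MvPolynomial (Fin n) ℝ) (e e' : Fin n → ℝ)
    (hhom : h.IsHomogeneous d) (hhyp : IsHyperbolicWrt h e)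
    (he' : e' ∈ hypCone h e) :
    ∀ x : Fin n → ℝ,
      (MvPolynomial.aeval (fun i => Polynomial.C (e i) +
        Polynomial.X * Polynomial.C (x i)) h : Polynomial ℝ).natDegree =
      (MvPolynomial.aeval (fun i => Polynomial.C (e' i) +
        Polynomial.X * Polynomial.C (x i)) h : Polynomial ℝ).natDegree := by
  intro x
  change (linePoly h e x).natDegree = (linePoly h e' x).natDegree
  rw [← natDegree_linePoly_complexify, ← natDegree_linePoly_complexify]
  exact le_antisymm
    (natDegree_linePoly_le_of_isHyperbolicWrt hhom (hhyp.of_mem_hypCone hhom he') e x)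
    (natDegree_linePoly_le_of_isHyperbolicWrt hhom hhyp e' x)
end

section
/- The support of any stable polynomial p ∈ ℂ[x₁,…,xₙ] is a jump system. Moreover, if all Taylor coefficients of the stable polynomial p are nonnegative and α, β ∈ supp(p) satisfy α ≤ β coordinatewise, then every γ ∈ ℕⁿ with α ≤ γ ≤ β also belongs to supp(p). -/
/-- `|γ| = Σᵢ |γᵢ|`. -/
def absSum {n : ℕ} (γ : Fin n → ℤ) : ℤ := ∑ i, |γ i|

/-- `s` is a step from `α` to `β`: `s` has exactly one nonzero coordinate, equal to `±1`
(i.e. `|s| = 1`), and `|α + s − β| < |α − β|`. -/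
def IsStep {n : ℕ} (α s β : Fin n → ℤ) : Prop :=
  absSum s = 1 ∧ absSum (α + s - β) < absSum (α - β)

/-- `𝒥 ⊆ ℤⁿ` is a jump system if whenever `α, β ∈ 𝒥`, `s` is a step from `α` to `β` and
`α + s ∉ 𝒥`, there is a step `t` from `α + s` to `β` with `α + s + t ∈ 𝒥`. -/
def IsJumpSystem {n : ℕ} (J : Set (Fin n → ℤ)) : Prop :=
  ∀ α ∈ J, ∀ β ∈ J, ∀ s : Fin n → ℤ, IsStep α s β → α + s ∉ J →
    ∃ t : Fin n → ℤ, IsStep (α + s) t β ∧ α + s + t ∈ J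

open ComplexConjugate

/-- A univariate polynomial without zeros in the open upper half-plane has logarithmic derivative
in the closed lower half-plane there. -/
theorem im_derivative_mul_conj_le {f : Polynomial ℂ}
    (hf : ∀ z : ℂ, 0 < z.im → f.eval z ≠ 0) {z : ℂ} (hz : 0 < z.im) :
    (f.derivative.eval z * conj (f.eval z)).im ≤ 0 := by
  have hroots : ∀ r ∈ f.roots, r.im ≤ 0 := by
    intro r hr
    by_contra! h
    exact hf r h (Polynomial.isRoot_of_mem_roots hr)
  have key : ∀ s : Multiset ℂ, (∀ r ∈ s, r.im ≤ 0) → ∀ c : ℂ,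
      ((Polynomial.C c * (s.map fun r => Polynomial.X - Polynomial.C r).prod).derivative.eval z *
        conj ((Polynomial.C c * (s.map fun r => Polynomial.X - Polynomial.C r).prod).eval z)).im
        ≤ 0 := by
    intro s
    induction s using Multiset.induction with
    | empty => simp
    | cons r s ih =>
      intro hs c
      have h1 := ih (fun r' hr' => hs r' (Multiset.mem_cons_of_mem hr')) c
      have h2 := hs r (Multiset.mem_cons_self r s)
      rw [Multiset.map_cons, Multiset.prod_cons, mul_left_comm]
      generalize Polynomial.C c * (s.map fun r => Polynomial.X - Polynomial.C r).prod = g at *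
      have e : (((Polynomial.X - Polynomial.C r) * g).derivative.eval z *
          conj (((Polynomial.X - Polynomial.C r) * g).eval z)) =
          (Complex.normSq (g.eval z) : ℂ) * conj (z - r) +
          (Complex.normSq (z - r) : ℂ) * (g.derivative.eval z * conj (g.eval z)) := by
        simp only [Complex.normSq_eq_conj_mul_self, Polynomial.derivative_mul, Polynomial.eval_add,
          Polynomial.eval_mul, Polynomial.derivative_X,
          Polynomial.derivative_C, Polynomial.eval_sub, Polynomial.eval_X, Polynomial.eval_C,
          Polynomial.eval_one, Polynomial.eval_zero, map_mul, map_sub]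
        ring
      rw [e, Complex.add_im, Complex.im_ofReal_mul, Complex.im_ofReal_mul, Complex.conj_im,
        Complex.sub_im]
      have h3 := Complex.normSq_nonneg (g.eval z)
      have h4 := Complex.normSq_nonneg (z - r)
      nlinarith [mul_nonneg h3 (by linarith : 0 ≤ z.im - r.im), mul_nonneg h4 (neg_nonneg.2 h1)]
  have := key f.roots hroots f.leadingCoeff
  rwa [← (IsAlgClosed.splits f).eq_prod_roots] at this

/-- A polynomial with `Im (f' / f) ≤ 0` on the upper half-plane, in the form free of division,
that has a zero there vanishes identically. -/
theorem eq_zero_of_im_derivative_mul_conj_le {f : Polynomial ℂ}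
    (hf : ∀ z : ℂ, 0 < z.im → (f.derivative.eval z * conj (f.eval z)).im ≤ 0) {r : ℂ}
    (hr : 0 < r.im) (h0 : f.eval r = 0) : f = 0 := by
  by_contra hne
  obtain ⟨g, hg, hgr⟩ := Polynomial.exists_eq_pow_rootMultiplicity_mul_and_not_dvd f hne r
  have hm : 0 < f.rootMultiplicity r := (Polynomial.rootMultiplicity_pos hne).2 h0
  obtain ⟨k, hk⟩ : ∃ k, f.rootMultiplicity r = k + 1 := ⟨_, (Nat.succ_pred_eq_of_pos hm).symm⟩
  rw [hk] at hg
  rw [Polynomial.dvd_iff_isRoot, Polynomial.IsRoot] at hgr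
  have key : ∀ δ ∈ Set.Ioo 0 r.im, (((k + 1 : ℂ) * g.eval (r - Complex.I * (δ : ℂ)) -
      Complex.I * δ * g.derivative.eval (r - Complex.I * (δ : ℂ))) *
      conj (g.eval (r - Complex.I * (δ : ℂ)))).re ≤ 0 := by
    intro δ hδ
    have h := hf (r - Complex.I * δ) (by simpa using hδ.2)
    set z := r - Complex.I * (δ : ℂ) with hz
    have e : f.derivative.eval z * conj (f.eval z) = ((δ ^ (2 * k + 1) : ℝ) : ℂ) *
        (Complex.I * (((k + 1 : ℂ) * g.eval z - Complex.I * δ * g.derivative.eval z) *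
          conj (g.eval z))) := by
      have hzr : z - r = -(Complex.I * δ) := by rw [hz]; ring
      have hI : (Complex.I * δ) ^ k * (-(Complex.I * δ)) ^ k = (δ : ℂ) ^ (2 * k) := by
        rw [← mul_pow, pow_mul]
        congr 1
        linear_combination (-(δ : ℂ) ^ 2) * Complex.I_sq
      rw [hg]
      simp only [Polynomial.derivative_mul, Polynomial.derivative_X_sub_C_pow, Polynomial.eval_add,
        Polynomial.eval_mul, Polynomial.eval_pow, Polynomial.eval_sub, Polynomial.eval_X,
        Polynomial.eval_C, map_mul, map_pow, hzr, map_neg, Complex.conj_I, Complex.conj_ofReal]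
      push_cast
      simp only [pow_succ, neg_mul, neg_neg]
      rw [← hI]
      ring
    rw [e, Complex.im_ofReal_mul, Complex.I_mul_im] at h
    exact nonpos_of_mul_nonpos_right h (pow_pos hδ.1 _)
  have hcont : Continuous fun δ : ℝ => (((k + 1 : ℂ) * g.eval (r - Complex.I * (δ : ℂ)) -
      Complex.I * δ * g.derivative.eval (r - Complex.I * (δ : ℂ))) *
      conj (g.eval (r - Complex.I * (δ : ℂ)))).re := by fun_prop
  have hlim := (hcont.tendsto 0).mono_left (nhdsWithin_le_nhds (s := Set.Ioi 0))
  have := le_of_tendsto hlim (Filter.mem_of_superset (Ioo_mem_nhdsGT hr) key)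
  have hpos := Complex.normSq_pos.2 hgr
  simp only [Complex.ofReal_zero, mul_zero, sub_zero, zero_mul, mul_assoc, Complex.mul_conj]
    at this
  norm_cast at this
  have h2 : (0 : ℝ) < ((k + 1 : ℕ) : ℝ) * Complex.normSq (g.eval r) := by positivity
  norm_cast at h2
  linarith

/-- If `Q = t ^ k * R` and `Im (Q / P) ≤ 0` on the upper half-plane, then the leading
coefficient of `Q / P` at the origin satisfies the limiting inequality. -/
theorem im_pow_mul_le {P R : Polynomial ℂ} {k : ℕ}
    (h : ∀ t : ℂ, 0 < t.im → ((Polynomial.X ^ k * R).eval t * conj (P.eval t)).im ≤ 0) {u : ℂ}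
    (hu : 0 < u.im) : (u ^ k * (R.eval 0 * conj (P.eval 0))).im ≤ 0 := by
  have key : ∀ δ ∈ Set.Ioi (0 : ℝ),
      (u ^ k * (R.eval (δ * u) * conj (P.eval (δ * u)))).im ≤ 0 := by
    intro δ hδ
    have := h (δ * u) (by simpa using mul_pos hδ hu)
    rw [Polynomial.eval_mul, Polynomial.eval_pow, Polynomial.eval_X, mul_pow, mul_assoc, mul_assoc,
      ← Complex.ofReal_pow, Complex.im_ofReal_mul] at this
    exact nonpos_of_mul_nonpos_right this (pow_pos hδ _)
  have hcont : Continuous fun δ : ℝ =>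
      (u ^ k * (R.eval (δ * u) * conj (P.eval (δ * u)))).im := by fun_prop
  have hlim := (hcont.tendsto 0).mono_left (nhdsWithin_le_nhds (s := Set.Ioi 0))
  simpa using le_of_tendsto hlim (Filter.mem_of_superset self_mem_nhdsWithin key)

/-- For `k ≥ 2` the `k`-th powers of points of the upper half-plane take all arguments in
`(0, 2π)`, hence can rotate any nonzero `w` into the upper half-plane. -/
theorem exists_im_pow_mul_pos {k : ℕ} (hk : 2 ≤ k) {w : ℂ} (hw : w ≠ 0) :
    ∃ u : ℂ, 0 < u.im ∧ 0 < (u ^ k * w).im := by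
  have hk' : (2 : ℝ) ≤ k := by exact_mod_cast hk
  have aux : ∀ θ : ℝ, 0 < θ → θ < 2 * Real.pi → 0 < Real.cos θ * w.im + Real.sin θ * w.re →
      ∃ u : ℂ, 0 < u.im ∧ 0 < (u ^ k * w).im := by
    intro θ h0 h1 h
    refine ⟨Complex.exp ((θ / k : ℝ) * Complex.I), ?_, ?_⟩
    · rw [Complex.exp_ofReal_mul_I_im]
      refine Real.sin_pos_of_pos_of_lt_pi (by positivity) ?_
      rw [div_lt_iff₀ (by positivity)]
      nlinarith [Real.pi_pos]
    · rw [← Complex.exp_nat_mul]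
      have : (k : ℂ) * ((θ / k : ℝ) * Complex.I) = (θ : ℝ) * Complex.I := by
        have : (k : ℂ) ≠ 0 := by norm_cast; omega
        push_cast
        field_simp
      rw [this, Complex.mul_im, Complex.exp_ofReal_mul_I_re, Complex.exp_ofReal_mul_I_im]
      exact h
  have hpi := Real.pi_pos
  rcases lt_trichotomy w.re 0 with hre | hre | hre
  · refine aux (Real.pi / 2 + Real.pi) (by linarith) (by linarith) ?_
    rw [Real.cos_add_pi, Real.sin_add_pi]
    simpa using hre
  · rcases lt_trichotomy w.im 0 with him | him | him
    · exact aux Real.pi hpi (by linarith) (by simpa using him)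
    · exact absurd (Complex.ext hre him) hw
    · refine aux (Real.pi / 4) (by linarith) (by linarith) ?_
      rw [hre, Real.cos_pi_div_four]
      simpa using him
  · exact aux (Real.pi / 2) (by linarith) (by linarith) (by simpa using hre)

/-- Suppose `Im (Q / P) ≤ 0` on the upper half-plane, where `P 0 ≠ 0` and `Q 0 = 0`. If the linear
coefficient of `Q / P` at the origin vanishes or has positive real part, then `Q = 0`. -/
theorem eq_zero_of_im_mul_conj_le {P Q : Polynomial ℂ} (hP : P.coeff 0 ≠ 0)
    (h0 : Q.coeff 0 = 0) (h1 : Q.coeff 1 ≠ 0 → 0 < (Q.coeff 1 * conj (P.coeff 0)).re)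
    (h : ∀ t : ℂ, 0 < t.im → (Q.eval t * conj (P.eval t)).im ≤ 0) : Q = 0 := by
  by_contra hne
  obtain ⟨R, hR, hR0⟩ := Polynomial.exists_eq_pow_rootMultiplicity_mul_and_not_dvd Q hne 0
  generalize Q.rootMultiplicity 0 = k at hR
  rw [Polynomial.dvd_iff_isRoot, Polynomial.IsRoot] at hR0
  rw [Polynomial.C_0, sub_zero] at hR
  subst hR
  have hw : R.eval 0 * conj (P.eval 0) ≠ 0 := by
    simpa [← Polynomial.coeff_zero_eq_eval_zero] using
      ⟨by rwa [Polynomial.coeff_zero_eq_eval_zero], hP⟩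
  match k, h0, h1, h with
  | 0, h0, _, _ =>
    rw [pow_zero, one_mul, Polynomial.coeff_zero_eq_eval_zero] at h0
    exact hR0 h0
  | 1, _, h1, h =>
    have := im_pow_mul_le h (u := Complex.I) (by simp)
    have e : (Polynomial.X ^ 1 * R).coeff 1 = R.eval 0 := by
      simp [Polynomial.coeff_zero_eq_eval_zero]
    rw [e] at h1
    rw [pow_one, Complex.I_mul_im, ← Polynomial.coeff_zero_eq_eval_zero P] at this
    exact (h1 hR0).not_ge this
  | k + 2, _, _, h =>
    obtain ⟨u, hu, hpos⟩ := exists_im_pow_mul_pos (k := k + 2) (by omega) hw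
    exact (im_pow_mul_le h hu).not_gt hpos

/-- `p` has no zeros with all coordinates in the open upper half-plane, or `p = 0`. -/
def StableOrZero {n : ℕ} (p : MvPolynomial (Fin n) ℂ) : Prop :=
  p = 0 ∨ ∀ x : Fin n → ℂ, (∀ j, 0 < (x j).im) → MvPolynomial.eval x p ≠ 0

/-- The restriction of `p` to the line through `x` parallel to the `i`-th axis. -/
noncomputable def axisRestrict {n : ℕ} (i : Fin n) (x : Fin n → ℂ) :
    MvPolynomial (Fin n) ℂ →ₐ[ℂ] Polynomial ℂ :=
  MvPolynomial.aeval (Function.update (fun j => Polynomial.C (x j)) i Polynomial.X)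

theorem eval_axisRestrict {n : ℕ} (i : Fin n) (x : Fin n → ℂ) (p : MvPolynomial (Fin n) ℂ)
    (z : ℂ) : (axisRestrict i x p).eval z = MvPolynomial.eval (Function.update x i z) p := by
  induction p using MvPolynomial.induction_on with
  | C a => simp [axisRestrict]
  | add p q hp hq => simp [hp, hq]
  | mul_X p j hp =>
    rw [map_mul, Polynomial.eval_mul, hp, map_mul]
    rcases eq_or_ne j i with rfl | hj
    · simp [axisRestrict]
    · simp [axisRestrict, hj]

theorem derivative_axisRestrict {n : ℕ} (i : Fin n) (x : Fin n → ℂ)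
    (p : MvPolynomial (Fin n) ℂ) :
    (axisRestrict i x p).derivative = axisRestrict i x (MvPolynomial.pderiv i p) := by
  induction p using MvPolynomial.induction_on with
  | C a => simp [axisRestrict]
  | add p q hp hq => simp [hp, hq]
  | mul_X p j hp =>
    rw [map_mul, Polynomial.derivative_mul, hp, MvPolynomial.pderiv_mul, map_add, map_mul, map_mul]
    rcases eq_or_ne j i with rfl | hj
    · simp [axisRestrict]
    · simp [axisRestrict, hj]

/-- A polynomial vanishing on the product of open upper half-planes is zero. -/
theorem eq_zero_of_eval_eq_zero_of_im_pos {n : ℕ} {p : MvPolynomial (Fin n) ℂ}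
    (h : ∀ x : Fin n → ℂ, (∀ j, 0 < (x j).im) → MvPolynomial.eval x p = 0) : p = 0 := by
  refine MvPolynomial.funext_set (fun _ => {z : ℂ | 0 < z.im}) (fun _ => ?_) fun x hx => ?_
  · refine Set.infinite_of_injective_forall_mem (f := fun k : ℕ => (k + 1 : ℂ) * Complex.I) ?_ ?_
    · intro a b hab
      simpa using hab
    · intro k
      simp only [Set.mem_ofPred_eq, Complex.mul_I_im, Complex.add_re, Complex.natCast_re,
        Complex.one_re]
      positivity
  · rw [h x fun j => hx j trivial, map_zero]

theorem stableOrZero_iff {n : ℕ} {p : MvPolynomial (Fin n) ℂ} :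
    StableOrZero p ↔ ∀ x : Fin n → ℂ, (∀ j, 0 < (x j).im) → ∀ i,
      (MvPolynomial.eval x (MvPolynomial.pderiv i p) * conj (MvPolynomial.eval x p)).im ≤ 0 := by
  constructor
  · rintro (rfl | hp) x hx i
    · simp
    · have := im_derivative_mul_conj_le (f := axisRestrict i x p) (fun z hz => by
        rw [eval_axisRestrict]
        refine hp _ fun j => ?_
        rcases eq_or_ne j i with rfl | hj
        · simpa using hz
        · simpa [hj] using hx j) (hx i)
      rwa [derivative_axisRestrict, eval_axisRestrict, eval_axisRestrict,
        Function.update_eq_self] at this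
  · intro h
    by_contra hne
    simp only [StableOrZero, not_or, not_forall, not_not] at hne
    obtain ⟨hp, x, hx, hx0⟩ := hne
    refine hp (eq_zero_of_eval_eq_zero_of_im_pos fun y hy => ?_)
    have key : ∀ s : Finset (Fin n), MvPolynomial.eval (s.piecewise y x) p = 0 := by
      intro s
      induction s using Finset.induction_on with
      | empty => simpa using hx0
      | insert i s _ ih =>
        have hpos : ∀ j, 0 < (s.piecewise y x j).im := fun j => by
          by_cases hj : j ∈ s
          · simpa [hj] using hy j
          · simpa [hj] using hx j
        have h0 : axisRestrict i (s.piecewise y x) p = 0 := by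
          refine eq_zero_of_im_derivative_mul_conj_le (fun z hz => ?_) (hpos i) ?_
          · rw [derivative_axisRestrict, eval_axisRestrict, eval_axisRestrict]
            refine h _ (fun j => ?_) i
            rcases eq_or_ne j i with rfl | hj
            · simpa using hz
            · simpa [hj] using hpos j
          · rw [eval_axisRestrict, Function.update_eq_self, ih]
        rw [Finset.piecewise_insert, ← eval_axisRestrict, h0, Polynomial.eval_zero]
    simpa using key Finset.univ

theorem StableOrZero.pderiv {n : ℕ} {p : MvPolynomial (Fin n) ℂ} (hp : StableOrZero p)
    (i : Fin n) : StableOrZero (MvPolynomial.pderiv i p) := by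
  rcases hp with rfl | hp
  · exact Or.inl (map_zero _)
  rw [stableOrZero_iff]
  intro x hx j
  have key : ∀ ε ∈ Set.Ioi (0 : ℝ),
      ((MvPolynomial.eval x (MvPolynomial.pderiv j (MvPolynomial.pderiv i p)) -
        (ε : ℂ) * Complex.I * MvPolynomial.eval x (MvPolynomial.pderiv j p)) *
      conj (MvPolynomial.eval x (MvPolynomial.pderiv i p) -
        (ε : ℂ) * Complex.I * MvPolynomial.eval x p)).im ≤ 0 := by
    intro ε hε
    have hst : StableOrZero
        (MvPolynomial.pderiv i p - MvPolynomial.C ((ε : ℂ) * Complex.I) * p) := by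
      refine Or.inr fun y hy h0 => ?_
      have h1 := stableOrZero_iff.1 (Or.inr hp) y hy i
      rw [map_sub, map_mul, MvPolynomial.eval_C, sub_eq_zero] at h0
      rw [h0, mul_assoc, Complex.mul_conj, mul_assoc, Complex.im_ofReal_mul, Complex.I_mul_im,
        Complex.ofReal_re] at h1
      exact h1.not_gt (mul_pos hε (Complex.normSq_pos.2 (hp y hy)))
    simpa [MvPolynomial.pderiv_C_mul] using stableOrZero_iff.1 hst x hx j
  have hcont : Continuous fun ε : ℝ =>
      ((MvPolynomial.eval x (MvPolynomial.pderiv j (MvPolynomial.pderiv i p)) -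
        (ε : ℂ) * Complex.I * MvPolynomial.eval x (MvPolynomial.pderiv j p)) *
      conj (MvPolynomial.eval x (MvPolynomial.pderiv i p) -
        (ε : ℂ) * Complex.I * MvPolynomial.eval x p)).im := by fun_prop
  have hlim := (hcont.tendsto 0).mono_left (nhdsWithin_le_nhds (s := Set.Ioi 0))
  simpa using le_of_tendsto hlim (Filter.mem_of_superset self_mem_nhdsWithin key)

/-- The restriction of `p` to the line through the origin in direction `v`. -/
noncomputable def lineRestrict {n : ℕ} (v : Fin n → ℂ) :
    MvPolynomial (Fin n) ℂ →ₐ[ℂ] Polynomial ℂ :=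
  MvPolynomial.aeval fun j => Polynomial.C (v j) * Polynomial.X

theorem eval_lineRestrict {n : ℕ} (v : Fin n → ℂ) (p : MvPolynomial (Fin n) ℂ) (t : ℂ) :
    (lineRestrict v p).eval t = MvPolynomial.eval (fun j => v j * t) p := by
  induction p using MvPolynomial.induction_on with
  | C a => simp [lineRestrict]
  | add p q hp hq => simp [hp, hq]
  | mul_X p j hp => rw [map_mul, Polynomial.eval_mul, hp, map_mul]; simp [lineRestrict]

theorem coeff_lineRestrict {n : ℕ} (v : Fin n → ℂ) (p : MvPolynomial (Fin n) ℂ) (k : ℕ) :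
    (lineRestrict v p).coeff k =
      ∑ γ ∈ p.support, if k = ∑ j, γ j then p.coeff γ * ∏ j, v j ^ γ j else 0 := by
  conv_lhs => rw [p.as_sum]
  rw [map_sum, Polynomial.finsetSum_coeff]
  refine Finset.sum_congr rfl fun γ _ => ?_
  have : lineRestrict v (MvPolynomial.monomial γ (p.coeff γ)) =
      Polynomial.C (p.coeff γ * ∏ j, v j ^ γ j) * Polynomial.X ^ ∑ j, γ j := by
    rw [lineRestrict, MvPolynomial.aeval_monomial, Finsupp.prod_fintype _ _ (fun _ => pow_zero _)]
    simp only [mul_pow, Finset.prod_mul_distrib, Finset.prod_pow_eq_pow_sum, map_mul, map_prod,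
      map_pow]
    rw [mul_assoc]; rfl
  rw [this, Polynomial.coeff_C_mul_X_pow]

theorem eq_single_of_sum_eq_one {n : ℕ} {γ : Fin n →₀ ℕ} (h : ∑ j, γ j = 1) :
    ∃ j, γ = Finsupp.single j 1 := by
  refine (Finsupp.sum_eq_one_iff γ).1 ?_
  rwa [Finsupp.sum_fintype _ _ fun _ => rfl]

/-- If `p` is stable with nonzero constant term and `∂ᵢp ≠ 0`, but `xᵢ` does not occur in `p`, then
some `xⱼ xᵢ` occurs, with a coefficient `c` such that `Re (c / p 0) ≤ 0`. -/
theorem exists_coeff_single_add_single_ne_zero {n : ℕ} {p : MvPolynomial (Fin n) ℂ} (hp : StableOrZero p)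
    (h0 : p.coeff 0 ≠ 0) {i : Fin n} (hi : MvPolynomial.pderiv i p ≠ 0)
    (h1 : p.coeff (Finsupp.single i 1) = 0) :
    ∃ j, p.coeff (Finsupp.single j 1 + Finsupp.single i 1) ≠ 0 ∧
      (p.coeff (Finsupp.single j 1 + Finsupp.single i 1) * conj (p.coeff 0)).re ≤ 0 := by
  by_contra! hcon
  obtain ⟨v, hv, hv0⟩ : ∃ v : Fin n → ℝ, (∀ j, 0 < v j) ∧
      MvPolynomial.eval (fun j => (v j : ℂ)) (MvPolynomial.pderiv i p) ≠ 0 := by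
    by_contra! hall
    refine hi (MvPolynomial.funext_set (fun _ => (fun r : ℝ => (r : ℂ)) '' Set.Ioi 0)
      (fun _ => (Set.Ioi_infinite 0).image Complex.ofReal_injective.injOn) fun x hx => ?_)
    choose v hv hvx using fun j => hx j trivial
    rw [map_zero, ← hall v hv]
    simp only [hvx]
  have hval (q : MvPolynomial (Fin n) ℂ) :
      (lineRestrict (fun j => (v j : ℂ)) q).coeff 0 = q.coeff 0 := by
    rw [Polynomial.coeff_zero_eq_eval_zero, eval_lineRestrict]
    simp only [mul_zero]
    rw [MvPolynomial.eval_zero', MvPolynomial.constantCoeff_eq]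
  have hQ : lineRestrict (fun j => (v j : ℂ)) (MvPolynomial.pderiv i p) = 0 := by
    refine eq_zero_of_im_mul_conj_le (P := lineRestrict (fun j => (v j : ℂ)) p) ?_ ?_ ?_ ?_
    · rwa [hval]
    · rw [hval, MvPolynomial.coeff_pderiv, zero_add, h1, zero_mul]
    · intro hne
      rw [hval, coeff_lineRestrict, Finset.sum_mul, Complex.re_sum]
      rw [coeff_lineRestrict] at hne
      obtain ⟨γ, hγ, hγne⟩ := Finset.exists_ne_zero_of_sum_ne_zero hne
      have hterm : ∀ γ ∈ (MvPolynomial.pderiv i p).support, 1 = ∑ j, γ j →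
          0 < (((MvPolynomial.pderiv i p).coeff γ * ∏ j, (v j : ℂ) ^ γ j) *
            conj (p.coeff 0)).re := by
        intro γ hγ hs
        obtain ⟨j, rfl⟩ := eq_single_of_sum_eq_one hs.symm
        rw [MvPolynomial.mem_support_iff, MvPolynomial.coeff_pderiv] at hγ
        have := hcon j (left_ne_zero_of_mul hγ)
        rw [MvPolynomial.coeff_pderiv]
        have e : p.coeff (Finsupp.single j 1 + Finsupp.single i 1) *
            (((Finsupp.single j 1 : Fin n →₀ ℕ) i : ℂ) + 1) *
            (∏ l, (v l : ℂ) ^ (Finsupp.single j 1 : Fin n →₀ ℕ) l) * conj (p.coeff 0) =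
            (((((Finsupp.single j 1 : Fin n →₀ ℕ) i : ℝ) + 1) *
              ∏ l, v l ^ (Finsupp.single j 1 : Fin n →₀ ℕ) l : ℝ) : ℂ) *
            (p.coeff (Finsupp.single j 1 + Finsupp.single i 1) * conj (p.coeff 0)) := by
          push_cast
          ring
        rw [e, Complex.re_ofReal_mul]
        have : 0 < ∏ l, v l ^ (Finsupp.single j 1 : Fin n →₀ ℕ) l :=
          Finset.prod_pos fun l _ => pow_pos (hv l) _
        positivity
      refine Finset.sum_pos' (fun γ hγ => ?_) ⟨γ, hγ, ?_⟩
      · split_ifs with hs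
        · exact (hterm γ hγ hs).le
        · simp
      · rw [if_pos (of_not_not fun hs => hγne (if_neg hs))]
        exact hterm γ hγ (of_not_not fun hs => hγne (if_neg hs))
    · intro t ht
      rw [eval_lineRestrict, eval_lineRestrict]
      refine stableOrZero_iff.1 hp _ (fun j => ?_) i
      rw [Complex.im_ofReal_mul]
      exact mul_pos (hv j) ht
  have := eval_lineRestrict (fun j => (v j : ℂ)) (MvPolynomial.pderiv i p) 1
  rw [hQ] at this
  simp only [mul_one, Polynomial.eval_zero] at this
  exact hv0 this.symm

theorem StableOrZero.exists_coeff_eq_mul_coeff_add {n : ℕ} (α : Fin n →₀ ℕ) :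
    ∀ {p : MvPolynomial (Fin n) ℂ}, StableOrZero p → ∃ q : MvPolynomial (Fin n) ℂ,
      StableOrZero q ∧ ∀ δ, ∃ c : ℝ, 0 < c ∧ q.coeff δ = c * p.coeff (δ + α) := by
  induction α using Finsupp.induction_linear with
  | zero => exact fun {p} hp => ⟨p, hp, fun δ => ⟨1, one_pos, by simp⟩⟩
  | add α β hα hβ =>
    intro p hp
    obtain ⟨q, hq, h⟩ := hβ hp
    obtain ⟨r, hr, h'⟩ := hα hq
    refine ⟨r, hr, fun δ => ?_⟩
    obtain ⟨c, hc, e⟩ := h (δ + α)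
    obtain ⟨c', hc', e'⟩ := h' δ
    exact ⟨c' * c, mul_pos hc' hc, by rw [e', e, add_assoc]; push_cast; ring⟩
  | single i a =>
    intro p hp
    induction a with
    | zero => exact ⟨p, hp, fun δ => ⟨1, one_pos, by simp⟩⟩
    | succ a ih =>
      obtain ⟨q, hq, h⟩ := ih
      refine ⟨MvPolynomial.pderiv i q, hq.pderiv i, fun δ => ?_⟩
      obtain ⟨c, hc, e⟩ := h (δ + Finsupp.single i 1)
      refine ⟨c * (δ i + 1), by positivity, ?_⟩
      rw [MvPolynomial.coeff_pderiv, e, add_assoc, ← Finsupp.single_add, add_comm 1 a]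
      push_cast
      ring

theorem pderiv_ne_zero_of_coeff_ne_zero {n : ℕ} {p : MvPolynomial (Fin n) ℂ} {μ : Fin n →₀ ℕ}
    (hμ : p.coeff μ ≠ 0) {i : Fin n} (hi : μ i ≠ 0) : MvPolynomial.pderiv i p ≠ 0 := by
  intro h
  have h1 := MvPolynomial.coeff_pderiv (i := i) p (μ - Finsupp.single i 1)
  rw [h, MvPolynomial.coeff_zero, Finsupp.sub_add_single_one_cancel hi] at h1
  exact mul_ne_zero hμ (Nat.cast_add_one_ne_zero _) h1.symm

/-- In a stable polynomial with nonnegative coefficients one can move from any exponent in the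
support one step upwards, in any direction in which some larger exponent lies. -/
theorem coeff_add_single_ne_zero {n : ℕ} {p : MvPolynomial (Fin n) ℂ} (hp : StableOrZero p)
    (hnn : ∀ α, 0 ≤ (p.coeff α).re ∧ (p.coeff α).im = 0) {α β : Fin n →₀ ℕ}
    (hα : p.coeff α ≠ 0) (hβ : p.coeff β ≠ 0) {i : Fin n} (h : α + Finsupp.single i 1 ≤ β) :
    p.coeff (α + Finsupp.single i 1) ≠ 0 := by
  obtain ⟨q, hq, hqp⟩ := hp.exists_coeff_eq_mul_coeff_add α
  have hre : ∀ δ, q.coeff δ ≠ 0 → 0 < (q.coeff δ).re ∧ (q.coeff δ).im = 0 := by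
    intro δ hδ
    obtain ⟨c, hc, e⟩ := hqp δ
    have him : (q.coeff δ).im = 0 := by rw [e, Complex.im_ofReal_mul, (hnn _).2, mul_zero]
    refine ⟨lt_of_le_of_ne ?_ fun h0 => hδ (Complex.ext h0.symm him), him⟩
    rw [e, Complex.re_ofReal_mul]
    exact mul_nonneg hc.le (hnn _).1
  have hne : ∀ δ, q.coeff δ ≠ 0 ↔ p.coeff (δ + α) ≠ 0 := by
    intro δ
    obtain ⟨c, hc, e⟩ := hqp δ
    rw [e]
    simp [hc.ne']
  have hle : α ≤ β := le_self_add.trans h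
  have h0 : q.coeff 0 ≠ 0 := (hne 0).2 (by rwa [zero_add])
  have hd : MvPolynomial.pderiv i q ≠ 0 := by
    refine pderiv_ne_zero_of_coeff_ne_zero (μ := β - α) ((hne _).2 ?_) ?_
    · rwa [tsub_add_cancel_of_le hle]
    · have := h i
      simp only [Finsupp.add_apply, Finsupp.single_eq_same] at this
      rw [Finsupp.tsub_apply]
      omega
  rw [add_comm, ← hne]
  intro h1
  obtain ⟨j, hj, hle0⟩ := exists_coeff_single_add_single_ne_zero hq h0 hd h1
  rw [Complex.mul_re, Complex.conj_re, Complex.conj_im, (hre _ hj).2, zero_mul, sub_zero] at hle0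
  exact hle0.not_gt (mul_pos (hre _ hj).1 (hre _ h0).1)

theorem coeff_add_ne_zero {n : ℕ} {p : MvPolynomial (Fin n) ℂ} (hp : StableOrZero p)
    (hnn : ∀ α, 0 ≤ (p.coeff α).re ∧ (p.coeff α).im = 0) {β : Fin n →₀ ℕ}
    (hβ : p.coeff β ≠ 0) (δ : Fin n →₀ ℕ) :
    ∀ {α : Fin n →₀ ℕ}, p.coeff α ≠ 0 → α + δ ≤ β → p.coeff (α + δ) ≠ 0 := by
  induction δ using Finsupp.induction_linear with
  | zero => exact fun {α} hα _ => by rwa [add_zero]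
  | add δ ε hδ hε =>
    intro α hα h
    rw [← add_assoc] at h ⊢
    exact hε (hδ hα (le_self_add.trans h)) h
  | single i k =>
    intro α hα
    induction k with
    | zero => exact fun _ => by rwa [Finsupp.single_zero, add_zero]
    | succ k ih =>
      intro h
      rw [Finsupp.single_add, ← add_assoc] at h ⊢
      exact coeff_add_single_ne_zero hp hnn (ih (le_self_add.trans h)) hβ h

/-- `S` is the support of a polynomial that is stable or zero. -/
def IsStableSupport {n : ℕ} (S : Set (Fin n → ℕ)) : Prop :=
  ∃ q : MvPolynomial (Fin n) ℂ, StableOrZero q ∧ ∀ γ : Fin n →₀ ℕ, ⇑γ ∈ S ↔ q.coeff γ ≠ 0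

theorem IsStableSupport.shift {n : ℕ} {S : Set (Fin n → ℕ)} (hS : IsStableSupport S) (i : Fin n)
    (a : ℕ) : IsStableSupport {δ | Function.update δ i (a + δ i) ∈ S} := by
  obtain ⟨p, hp, h⟩ := hS
  obtain ⟨q, hq, hqp⟩ := hp.exists_coeff_eq_mul_coeff_add (Finsupp.single i a)
  refine ⟨q, hq, fun γ => ?_⟩
  obtain ⟨c, hc, e⟩ := hqp γ
  have : Function.update γ i (a + γ i) = ⇑(γ + Finsupp.single i a) := by
    ext j
    rcases eq_or_ne j i with rfl | hj
    · simp [add_comm]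
    · simp [hj]
  rw [Set.mem_ofPred_eq, this, h, e]
  simp [hc.ne']

theorem IsStableSupport.reflect {n : ℕ} {S : Set (Fin n → ℕ)} (hS : IsStableSupport S)
    (i : Fin n) (d : ℕ) (hd : ∀ γ ∈ S, γ i ≤ d) :
    IsStableSupport {δ | δ i ≤ d ∧ Function.update δ i (d - δ i) ∈ S} := by
  obtain ⟨p, hp, h⟩ := hS
  have hd' : ∀ γ ∈ p.support, γ i ≤ d := fun γ hγ =>
    hd _ ((h γ).2 (MvPolynomial.mem_support_iff.1 hγ))
  refine ⟨∑ γ ∈ p.support, MvPolynomial.monomial (γ.update i (d - γ i))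
    ((-1) ^ γ i * p.coeff γ), ?_, fun δ => ?_⟩
  · rcases hp with rfl | hp
    · exact Or.inl (by simp)
    refine Or.inr fun x hx => ?_
    have hxi : x i ≠ 0 := fun h0 => by simpa [h0] using hx i
    have e : MvPolynomial.eval x (∑ γ ∈ p.support, MvPolynomial.monomial (γ.update i (d - γ i))
        ((-1) ^ γ i * p.coeff γ)) =
        x i ^ d * MvPolynomial.eval (Function.update x i (-(x i)⁻¹)) p := by
      rw [map_sum, MvPolynomial.eval_eq', Finset.mul_sum]
      refine Finset.sum_congr rfl fun γ hγ => ?_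
      rw [MvPolynomial.eval_monomial, Finsupp.prod_fintype _ _ (fun _ => pow_zero _),
        ← Finset.mul_prod_erase _ _ (Finset.mem_univ i),
        ← Finset.mul_prod_erase _ _ (Finset.mem_univ i)]
      have : ∏ j ∈ Finset.univ.erase i, x j ^ (γ.update i (d - γ i)) j =
          ∏ j ∈ Finset.univ.erase i, Function.update x i (-(x i)⁻¹) j ^ γ j :=
        Finset.prod_congr rfl fun j hj => by simp [Finset.ne_of_mem_erase hj]
      rw [this]
      obtain ⟨m, rfl⟩ := Nat.exists_eq_add_of_le (hd' γ hγ)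
      simp only [Finsupp.coe_update, Function.update_self, Nat.add_sub_cancel_left]
      rw [neg_pow (x i)⁻¹, inv_pow, pow_add]
      field_simp
    rw [e]
    refine mul_ne_zero (pow_ne_zero _ hxi) (hp _ fun j => ?_)
    rcases eq_or_ne j i with rfl | hj
    · rw [Function.update_self, Complex.neg_im, Complex.inv_im, neg_div, neg_neg]
      exact div_pos (hx j) (Complex.normSq_pos.2 hxi)
    · simpa [hj] using hx j
  · have hmem : Function.update δ i (d - δ i) ∈ S ↔ p.coeff (δ.update i (d - δ i)) ≠ 0 := by
      rw [← h, Finsupp.coe_update]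
    rw [Set.mem_ofPred_eq, hmem, MvPolynomial.coeff_sum]
    simp only [MvPolynomial.coeff_monomial]
    constructor
    · rintro ⟨hδ, hne⟩
      rw [Finset.sum_eq_single (δ.update i (d - δ i))]
      · rw [if_pos]
        · exact mul_ne_zero (pow_ne_zero _ (by norm_num)) hne
        · ext j
          rcases eq_or_ne j i with rfl | hj
          · simp [Nat.sub_sub_self hδ]
          · simp [hj]
      · intro γ hγ hγδ
        rw [if_neg]
        rintro rfl
        refine hγδ ?_
        ext j
        rcases eq_or_ne j i with rfl | hj
        · simp [Nat.sub_sub_self (hd' γ hγ)]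
        · simp [hj]
      · intro hns
        rw [MvPolynomial.notMem_support_iff.1 hns]
        simp
    · intro hne
      obtain ⟨γ, hγ, hγne⟩ := Finset.exists_ne_zero_of_sum_ne_zero hne
      obtain rfl : γ.update i (d - γ i) = δ := of_not_not fun hs => hγne (if_neg hs)
      refine ⟨by simp, ?_⟩
      have : (γ.update i (d - γ i)).update i (d - (γ.update i (d - γ i)) i) = γ := by
        ext j
        rcases eq_or_ne j i with rfl | hj
        · simp [Nat.sub_sub_self (hd' γ hγ)]
        · simp [hj]
      rw [this]
      exact MvPolynomial.mem_support_iff.1 hγ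

theorem IsStableSupport.truncate {n : ℕ} {S : Set (Fin n → ℕ)} (hS : IsStableSupport S)
    (i : Fin n) (m : ℕ) : IsStableSupport {δ | δ i ≤ m ∧ δ ∈ S} := by
  obtain ⟨d, hmd, hd⟩ : ∃ d, m ≤ d ∧ ∀ γ ∈ S, γ i ≤ d := by
    obtain ⟨p, -, h⟩ := hS
    refine ⟨max m (p.degreeOf i), le_max_left _ _, fun γ hγ => le_max_of_le_right ?_⟩
    have := (h (Finsupp.equivFunOnFinite.symm γ)).1 (by simpa using hγ)
    simpa using MvPolynomial.monomial_le_degreeOf i (MvPolynomial.mem_support_iff.2 this)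
  have h := ((hS.reflect i d hd).shift i (d - m)).reflect i m (fun γ hγ => by
    have := hγ.1
    simp only [Function.update_self] at this
    omega)
  convert h using 1
  ext δ
  simp only [Set.mem_ofPred_eq, Function.update_self, Function.update_idem]
  refine and_congr_right fun hδ => ?_
  have e : d - (d - m + (m - δ i)) = δ i := by omega
  rw [e, Function.update_eq_self]
  exact ⟨fun hδ => ⟨by omega, hδ⟩, fun hδ => hδ.2⟩

/-- The point at distance `k` from `a` in the direction of `b`. -/
def moveTowards (a b k : ℕ) : ℕ := if a ≤ b then a + k else a - k

theorem IsStableSupport.window {n : ℕ} {S : Set (Fin n → ℕ)} (hS : IsStableSupport S)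
    (i : Fin n) (a b : ℕ) :
    IsStableSupport {δ | δ i ≤ Nat.dist a b ∧
      Function.update δ i (moveTowards a b (δ i)) ∈ S} := by
  unfold moveTowards
  split_ifs with hab
  · exact (hS.shift i a).truncate i _
  · have h := ((hS.truncate i a).reflect i a fun γ hγ => hγ.1).truncate i (Nat.dist a b)
    convert h using 1
    ext δ
    simp only [Set.mem_ofPred_eq, Function.update_self]
    refine and_congr_right fun hδ => ?_
    rw [Nat.dist] at hδ
    exact ⟨fun hS => ⟨by omega, by omega, hS⟩, fun hS => hS.2.2⟩

theorem IsStableSupport.box {n : ℕ} {S : Set (Fin n → ℕ)} (hS : IsStableSupport S)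
    (a b : Fin n → ℕ) :
    IsStableSupport {δ | (∀ i, δ i ≤ Nat.dist (a i) (b i)) ∧
      (fun i => moveTowards (a i) (b i) (δ i)) ∈ S} := by
  have key : ∀ T : Finset (Fin n), IsStableSupport {δ | (∀ i ∈ T, δ i ≤ Nat.dist (a i) (b i)) ∧
      T.piecewise (fun i => moveTowards (a i) (b i) (δ i)) δ ∈ S} := by
    intro T
    induction T using Finset.induction_on with
    | empty => simpa using hS
    | insert i T hi ih =>
      convert ih.window i (a i) (b i) using 1
      ext δ
      simp only [Set.mem_ofPred_eq, Finset.forall_mem_insert, and_assoc]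
      refine and_congr_right fun _ => and_congr (forall₂_congr fun j hj => ?_) ?_
      · rw [Function.update_of_ne (ne_of_mem_of_not_mem hj hi)]
      · refine iff_of_eq (congrArg (· ∈ S) ?_)
        ext j
        rcases eq_or_ne j i with rfl | hj
        · simp [hi]
        · by_cases hjT : j ∈ T <;> simp [hj, hjT]
  simpa using key Finset.univ

theorem exists_eq_single_of_absSum_eq_one {n : ℕ} {s : Fin n → ℤ} (hs : absSum s = 1) :
    ∃ i, |s i| = 1 ∧ s = Pi.single i (s i) := by
  obtain ⟨i, hi⟩ := eq_single_of_sum_eq_one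
    (γ := Finsupp.equivFunOnFinite.symm fun j => (s j).natAbs) (by
      simp only [absSum, Int.abs_eq_natAbs] at hs
      simpa using by exact_mod_cast hs)
  have h : ∀ j, (s j).natAbs = (Finsupp.single i 1 : Fin n →₀ ℕ) j := fun j =>
    DFunLike.congr_fun hi j
  refine ⟨i, by simp [Int.abs_eq_natAbs, h], ?_⟩
  ext j
  rcases eq_or_ne j i with rfl | hj
  · simp
  · simpa [hj, Finsupp.single_apply, hj.symm] using h j

/-- A step from `α` to `β` moves a single coordinate by one in the direction of `β`. -/
theorem IsStep.exists_add_eq {n : ℕ} {a b : Fin n → ℕ} {s : Fin n → ℤ}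
    (hs : IsStep (fun j => (a j : ℤ)) s (fun j => (b j : ℤ))) :
    ∃ i, a i ≠ b i ∧ (fun j => (a j : ℤ)) + s =
      fun j => (moveTowards (a j) (b j) ((Finsupp.single i 1 : Fin n →₀ ℕ) j) : ℤ) := by
  obtain ⟨i, hi, hsi⟩ := exists_eq_single_of_absSum_eq_one hs.1
  have hlt : |(a i : ℤ) + s i - b i| < |(a i : ℤ) - b i| := by
    by_contra! hle
    refine hs.2.not_ge (Finset.sum_le_sum fun j _ => ?_)
    rcases eq_or_ne j i with rfl | hj
    · exact hle
    · rw [hsi]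
      simp [hj]
  refine ⟨i, by intro h; rw [h, sub_self, abs_zero] at hlt; exact (abs_nonneg _).not_gt hlt, ?_⟩
  ext j
  rcases eq_or_ne j i with rfl | hj
  · simp only [Int.abs_eq_natAbs] at hlt hi
    simp only [Pi.add_apply, moveTowards, Finsupp.single_eq_same]
    split_ifs <;> omega
  · rw [hsi]
    simp [hj, moveTowards]

theorem abs_moveTowards_sub {a b k : ℕ} (hk : k ≤ Nat.dist a b) :
    |(moveTowards a b k : ℤ) - b| = (Nat.dist a b : ℤ) - k := by
  rw [Int.abs_eq_natAbs]
  unfold moveTowards Nat.dist at *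
  split_ifs <;> omega

theorem abs_moveTowards_add_sub {a b k l : ℕ} (hk : k + l ≤ Nat.dist a b) :
    |(moveTowards a b (k + l) : ℤ) - moveTowards a b l| = k := by
  rw [Int.abs_eq_natAbs]
  unfold moveTowards Nat.dist at *
  split_ifs <;> omega

theorem isJumpSystem_of_isStableSupport {n : ℕ} {S : Set (Fin n → ℕ)} (hS : IsStableSupport S) :
    IsJumpSystem {γ : Fin n → ℤ | ∃ a ∈ S, γ = fun i => (a i : ℤ)} := by
  rintro _ ⟨a, ha, rfl⟩ _ ⟨b, hb, rfl⟩ s hs hns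
  obtain ⟨i, hi, hsi⟩ := hs.exists_add_eq
  obtain ⟨q, hq, hqS⟩ := hS.box a b
  have h0 : q.coeff 0 ≠ 0 := (hqS 0).1 (by simpa [moveTowards] using ha)
  have hm : q.coeff (Finsupp.equivFunOnFinite.symm fun j => Nat.dist (a j) (b j)) ≠ 0 := by
    refine (hqS _).1 ⟨fun j => le_rfl, ?_⟩
    convert hb using 1
    ext j
    simp only [moveTowards, Finsupp.equivFunOnFinite_symm_apply_apply, Nat.dist]
    split_ifs <;> omega
  have h1 : q.coeff (Finsupp.single i 1) = 0 := by
    by_contra h1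
    exact hns ⟨_, ((hqS _).2 h1).2, hsi⟩
  obtain ⟨j, hj, -⟩ := exists_coeff_single_add_single_ne_zero hq h0
    (pderiv_ne_zero_of_coeff_ne_zero hm (i := i) (by
      simp only [Finsupp.equivFunOnFinite_symm_apply_apply, Nat.dist]
      omega)) h1
  obtain ⟨hle, hmem⟩ := (hqS _).2 hj
  simp only [Finsupp.add_apply] at hle hmem
  have hsum : ∑ l, ((Finsupp.single j 1 : Fin n →₀ ℕ) l : ℤ) = 1 := by
    simp [Finsupp.single_apply]
  have hle' : ∀ l, (Finsupp.single i 1 : Fin n →₀ ℕ) l ≤ Nat.dist (a l) (b l) := fun l =>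
    le_add_self.trans (hle l)
  rw [hsi]
  refine ⟨(fun l => (moveTowards (a l) (b l) ((Finsupp.single j 1 : Fin n →₀ ℕ) l +
    (Finsupp.single i 1 : Fin n →₀ ℕ) l) : ℤ)) -
    fun l => (moveTowards (a l) (b l) ((Finsupp.single i 1 : Fin n →₀ ℕ) l) : ℤ), ⟨?_, ?_⟩,
    ⟨_, hmem, add_sub_cancel _ _⟩⟩
  · simp only [absSum, Pi.sub_apply, abs_moveTowards_add_sub (hle _), hsum]
  · rw [add_sub_cancel]
    simp only [absSum, Pi.sub_apply, abs_moveTowards_sub (hle _), abs_moveTowards_sub (hle' _),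
      Finset.sum_sub_distrib, Nat.cast_add, Finset.sum_add_distrib, hsum]
    omega

theorem stmt19 (n : ℕ) (p : MvPolynomial (Fin n) ℂ)
    (hstable : ∀ x : Fin n → ℂ, (∀ j, 0 < (x j).im) → MvPolynomial.eval x p ≠ 0) :
    IsJumpSystem {γ : Fin n → ℤ | ∃ α ∈ p.support, ∀ i, γ i = (α i : ℤ)} ∧
    ((∀ α : Fin n →₀ ℕ, 0 ≤ (MvPolynomial.coeff α p).re ∧ (MvPolynomial.coeff α p).im = 0) →
      ∀ α β γ : Fin n →₀ ℕ, α ∈ p.support → β ∈ p.support →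
        α ≤ β → α ≤ γ → γ ≤ β → γ ∈ p.support) := by
  have hp : StableOrZero p := Or.inr hstable
  constructor
  · have hS : IsStableSupport {a : Fin n → ℕ | ∃ α ∈ p.support, a = ⇑α} :=
      ⟨p, hp, fun γ => by simp⟩
    convert isJumpSystem_of_isStableSupport hS using 1
    ext γ
    constructor
    · rintro ⟨α, hα, h⟩
      exact ⟨α, ⟨α, hα, rfl⟩, funext h⟩
    · rintro ⟨_, ⟨α, hα, rfl⟩, rfl⟩
      exact ⟨α, hα, fun _ => rfl⟩
  · intro hnn α β γ hα hβ _ hαγ hγβ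
    rw [MvPolynomial.mem_support_iff] at *
    rw [← add_tsub_cancel_of_le hαγ] at hγβ ⊢
    exact coeff_add_ne_zero hp hnn hβ _ hα hγβ
end
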